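/- A non-trivial connected finite simple graph G is γβ-perfect if and only if G is not isomorphic to C_5 and G contains neither C_3 nor P_6 as a subgraph. -/

import Mathlib

open SimpleGraph

/-- `D` is a dominating set of `G`: every vertex not in `D` has a neighbor in `D`. -/
def IsDomSet {V : Type*} (G : SimpleGraph V) (D : Set V) : Prop :=
  ∀ v ∉ D, ∃ u ∈ D, G.Adj u v

/-- `C` is a vertex cover of `G`: every edge has an end-vertex in `C`. -/
def IsVtxCover {V : Type*} (G : SimpleGraph V) (C : Set V) : Prop :=
  ∀ ⦃u v : V⦄, G.Adj u v → u ∈ C ∨ v ∈ C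

/-- The domination number `γ(G)`. -/
noncomputable def domNum {V : Type*} (G : SimpleGraph V) : ℕ :=
  sInf {n | ∃ D : Set V, IsDomSet G D ∧ D.ncard = n}

/-- The covering number `β(G)`. -/
noncomputable def covNum {V : Type*} (G : SimpleGraph V) : ℕ :=
  sInf {n | ∃ C : Set V, IsVtxCover G C ∧ C.ncard = n}

/-- `G` is γβ-perfect: `G` is connected, has at least two vertices, and every
connected induced subgraph with at least two vertices satisfies `γ = β`. -/
def GammaBetaPerfect {V : Type*} [Fintype V] (G : SimpleGraph V) : Prop :=
  G.Connected ∧ 2 ≤ Fintype.card V ∧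
    ∀ S : Set V, (G.induce S).Connected → 2 ≤ S.ncard →
      domNum (G.induce S) = covNum (G.induce S)

/-- `G` contains a subgraph isomorphic to `F`, i.e. there is an injective
graph homomorphism from `F` to `G`. -/
def HasSubgraphCopy {α β : Type*} (F : SimpleGraph α) (G : SimpleGraph β) : Prop :=
  ∃ f : F →g G, Function.Injective f

/-- A bijective homomorphism transports dominating sets of `F` to `G` and vertex covers of `G`
back to `F`. -/
theorem domNum_lt_covNum_of_bijective {α β : Type*} [Fintype α] [DecidableEq α]
    {F : SimpleGraph α} {G : SimpleGraph β} (f : F →g G) (hf : Function.Bijective f)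
    (D : Finset α) (hD : ∀ v ∉ D, ∃ u ∈ D, F.Adj u v)
    (hC : ∀ C : Finset α, (∀ u v, F.Adj u v → u ∈ C ∨ v ∈ C) → D.card < C.card) :
    domNum G < covNum G := by
  classical
  have hfin : Finite β := Finite.of_surjective f hf.2
  have h1 : domNum G ≤ D.card := by
    refine Nat.sInf_le ⟨f '' D, ?_, ?_⟩
    · intro v hv
      obtain ⟨x, rfl⟩ := hf.2 v
      obtain ⟨u, hu, hux⟩ := hD x fun hx => hv ⟨x, hx, rfl⟩
      exact ⟨f u, ⟨u, hu, rfl⟩, f.map_adj hux⟩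
    · rw [Set.ncard_image_of_injective _ hf.1, Set.ncard_coe_finset]
  have hne : {n | ∃ C : Set β, IsVtxCover G C ∧ C.ncard = n}.Nonempty :=
    ⟨_, Set.univ, fun _ _ _ => Or.inl trivial, rfl⟩
  obtain ⟨C, hcov, hcard⟩ := Nat.sInf_mem hne
  have h2 : D.card < (Finset.univ.filter fun i => f i ∈ C).card :=
    hC _ fun u v huv => by simpa using hcov (f.map_adj huv)
  have h3 : (Finset.univ.filter fun i => f i ∈ C).card ≤ C.ncard := by
    rw [← Set.ncard_coe_finset]
    refine Set.ncard_le_ncard_of_injOn f ?_ hf.1.injOn (Set.toFinite _)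
    intro i hi
    simpa using hi
  change domNum G < sInf _
  omega

theorem not_gammaBetaPerfect_of_copy {V α : Type*} [Fintype V] [Fintype α] [DecidableEq α]
    {F : SimpleGraph α} {G : SimpleGraph V} (hF : F.Connected) (hα : 2 ≤ Fintype.card α)
    (D : Finset α) (hD : ∀ v ∉ D, ∃ u ∈ D, F.Adj u v)
    (hC : ∀ C : Finset α, (∀ u v, F.Adj u v → u ∈ C ∨ v ∈ C) → D.card < C.card)
    (h : HasSubgraphCopy F G) : ¬ GammaBetaPerfect G := by
  rintro ⟨-, -, hG⟩
  obtain ⟨f, hf⟩ := h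
  let g : F →g G.induce (Set.range f) := ⟨fun i => ⟨f i, i, rfl⟩, fun h => f.map_adj h⟩
  have hg : Function.Bijective g := by
    refine ⟨fun i j hij => hf (congrArg Subtype.val hij), ?_⟩
    rintro ⟨_, i, rfl⟩
    exact ⟨i, rfl⟩
  refine (domNum_lt_covNum_of_bijective g hg D hD hC).ne (hG _ ?_ ?_)
  · exact hF.map g hg.2
  · rwa [← Set.image_univ, Set.ncard_image_of_injective _ hf, Set.ncard_univ,
      Nat.card_eq_fintype_card]

theorem HasSubgraphCopy.of_induce {V α : Type*} {F : SimpleGraph α} {G : SimpleGraph V}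
    {S : Set V} (h : HasSubgraphCopy F (G.induce S)) : HasSubgraphCopy F G := by
  obtain ⟨f, hf⟩ := h
  exact ⟨(Embedding.induce S).toHom.comp f, Subtype.val_injective.comp hf⟩

theorem hasSubgraphCopy_cycleGraph_three {V : Type*} {G : SimpleGraph V} {a b c : V}
    (hab : G.Adj a b) (hbc : G.Adj b c) (hca : G.Adj c a) :
    HasSubgraphCopy (cycleGraph 3) G := by
  have h1 := hab.ne
  have h2 := hbc.ne
  have h3 := hca.ne
  refine ⟨⟨![a, b, c], ?_⟩, ?_⟩
  · intro i j hij
    fin_cases i <;> fin_cases j <;> first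
      | (exfalso; revert hij; decide)
      | (simp [hab, hbc, hca]; done)
      | simp [hab.symm, hbc.symm, hca.symm]
  · intro i j hij
    fin_cases i <;> fin_cases j <;> simp_all

theorem hasSubgraphCopy_cycleGraph_five {V : Type*} {G : SimpleGraph V} {a b c d e : V}
    (hab : G.Adj a b) (hbc : G.Adj b c) (hcd : G.Adj c d) (hde : G.Adj d e) (hea : G.Adj e a)
    (hn : [a, b, c, d, e].Nodup) : HasSubgraphCopy (cycleGraph 5) G := by
  refine ⟨⟨[a, b, c, d, e].get, ?_⟩, List.nodup_iff_injective_get.1 hn⟩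
  intro i j hij
  fin_cases i <;> fin_cases j <;> first
    | (exfalso; revert hij; decide)
    | (simp [hab, hbc, hcd, hde, hea]; done)
    | simp [hab.symm, hbc.symm, hcd.symm, hde.symm, hea.symm]

theorem hasSubgraphCopy_pathGraph_six {V : Type*} {G : SimpleGraph V} {a b c d e f : V}
    (hab : G.Adj a b) (hbc : G.Adj b c) (hcd : G.Adj c d) (hde : G.Adj d e) (hef : G.Adj e f)
    (hn : [a, b, c, d, e, f].Nodup) : HasSubgraphCopy (pathGraph 6) G := by
  refine ⟨⟨[a, b, c, d, e, f].get, ?_⟩, List.nodup_iff_injective_get.1 hn⟩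
  intro i j hij
  rw [pathGraph_adj] at hij
  fin_cases i <;> fin_cases j <;> first
    | (exfalso; revert hij; decide)
    | (simp [hab, hbc, hcd, hde, hef]; done)
    | simp [hab.symm, hbc.symm, hcd.symm, hde.symm, hef.symm]

theorem SimpleGraph.Connected.mem_of_adj_closed {V : Type*} {G : SimpleGraph V}
    (hG : G.Connected) {S : Set V} {a : V} (ha : a ∈ S)
    (hS : ∀ u ∈ S, ∀ v, G.Adj u v → v ∈ S) (v : V) : v ∈ S := by
  obtain ⟨p⟩ := hG.preconnected a v
  induction p with
  | nil => exact ha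
  | cons h _ ih => exact ih (hS _ ha _ h)

/-- In a connected graph without `C₃` and `P₆`, a `C₅` is the whole graph. -/
theorem nonempty_iso_cycleGraph_five {V : Type*} {G : SimpleGraph V} (hG : G.Connected)
    (h3 : ¬ HasSubgraphCopy (cycleGraph 3) G) (h6 : ¬ HasSubgraphCopy (pathGraph 6) G)
    (h5 : HasSubgraphCopy (cycleGraph 5) G) : Nonempty (G ≃g cycleGraph 5) := by
  obtain ⟨f, hf⟩ := h5
  have hadj : ∀ i : Fin 5, G.Adj (f i) (f (i + 1)) := fun i =>
    f.map_adj (by revert i; decide)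
  have hsurj : Function.Surjective f := by
    refine hG.mem_of_adj_closed (S := Set.range f) ⟨0, rfl⟩ ?_
    rintro _ ⟨i, rfl⟩ v hv
    by_contra hnot
    have hne : ∀ j, v ≠ f j := fun j hj => hnot ⟨j, hj.symm⟩
    refine h6 (hasSubgraphCopy_pathGraph_six hv.symm (hadj i) (hadj (i + 1)) (hadj (i + 1 + 1))
      (hadj (i + 1 + 1 + 1)) ?_)
    simp only [List.nodup_cons, List.mem_cons, List.not_mem_nil, hf.eq_iff, hne,
      List.nodup_nil]
    clear hv
    revert i
    decide
  refine ⟨(⟨Equiv.ofBijective f ⟨hf, hsurj⟩, ?_⟩ : cycleGraph 5 ≃g G).symm⟩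
  intro i j
  refine ⟨fun h => ?_, fun h => f.map_adj h⟩
  change G.Adj (f i) (f j) at h
  by_contra hij
  have hcases : ∀ i j : Fin 5, i ≠ j → ¬ (cycleGraph 5).Adj i j →
      j = i + 1 + 1 ∨ i = j + 1 + 1 := by decide
  obtain rfl | rfl := hcases i j (fun e => h.ne (congrArg f e)) hij
  · exact h3 (hasSubgraphCopy_cycleGraph_three (hadj _) (hadj _) h.symm)
  · exact h3 (hasSubgraphCopy_cycleGraph_three (hadj _) (hadj _) h)

/-- In a connected graph without `C₃` and `P₆`, some diagonal of a `C₄` covers all edges. -/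
theorem exists_isVtxCover_pair {V : Type*} {G : SimpleGraph V} (hG : G.Connected)
    (h3 : ¬ HasSubgraphCopy (cycleGraph 3) G) (h6 : ¬ HasSubgraphCopy (pathGraph 6) G)
    {a b c d : V} (hab : G.Adj a b) (hbc : G.Adj b c) (hcd : G.Adj c d) (hda : G.Adj d a)
    (hac : a ≠ c) (hbd : b ≠ d) : ∃ x y, IsVtxCover G {x, y} := by
  have t : ∀ {x y z}, G.Adj x y → G.Adj y z → ¬ G.Adj z x := fun h h' h'' =>
    h3 (hasSubgraphCopy_cycleGraph_three h h' h'')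
  -- It suffices to treat the case where no outside vertex is attached to `b` or `d`.
  have key : ∀ {a b c d : V}, G.Adj a b → G.Adj b c → G.Adj c d → G.Adj d a → a ≠ c → b ≠ d →
      (∀ v, G.Adj b v → v = a ∨ v = c) → (∀ v, G.Adj d v → v = a ∨ v = c) →
      IsVtxCover G {a, c} := by
    intro a b c d hab hbc hcd hda hac hbd hb hd
    have hout : ∀ x, x = a ∨ x = c ∨ ∀ y, G.Adj x y → y = a ∨ y = c := by
      have nopath : ∀ {a c : V}, G.Adj a b → G.Adj b c → G.Adj c d → G.Adj d a → a ≠ c →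
          (∀ v, G.Adj b v → v = a ∨ v = c) → (∀ v, G.Adj d v → v = a ∨ v = c) →
          ∀ x y, G.Adj a x → G.Adj x y → y = a ∨ y = c := by
        intro a c hab hbc hcd hda hac hb hd x y hax hxy
        by_contra! hy
        have hyb : y ≠ b := by rintro rfl; exact t hax hxy hab.symm
        have hyd : y ≠ d := by rintro rfl; exact t hax hxy hda
        have hxb : x ≠ b := by rintro rfl; exact (hb y hxy).elim hy.1 hy.2
        have hxd : x ≠ d := by rintro rfl; exact (hd y hxy).elim hy.1 hy.2
        have hxc : x ≠ c := by rintro rfl; exact t hab hbc hax.symm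
        refine h6 (hasSubgraphCopy_pathGraph_six hxy.symm hax.symm hab hbc hcd ?_)
        have := hab.ne
        have := hbc.ne
        have := hcd.ne
        have := hda.ne
        have := hax.ne
        have := hxy.ne
        simp only [List.nodup_cons, List.mem_cons, List.not_mem_nil]
        grind
      have h1 := nopath hab hbc hcd hda hac hb hd
      have h2 := nopath hbc.symm hab.symm hda.symm hcd.symm hac.symm
        (fun v hv => (hb v hv).symm) (fun v hv => (hd v hv).symm)
      refine hG.mem_of_adj_closed
        (S := {x | x = a ∨ x = c ∨ ∀ y, G.Adj x y → y = a ∨ y = c}) (Or.inl rfl) ?_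
      rintro u (rfl | rfl | hu) v huv
      · exact Or.inr (Or.inr fun y hy => h1 v y huv hy)
      · exact Or.inr (Or.inr fun y hy => (h2 v y huv hy).symm)
      · rcases hu v huv with h | h
        · exact Or.inl h
        · exact Or.inr (Or.inl h)
    intro u v huv
    rcases hout u with h | h | h
    · simp [h]
    · simp [h]
    · exact Or.inr (by simpa using h v huv)
  -- Outside neighbours cannot be attached to both ends of an edge of the cycle.
  have adjacent : ∀ {a b c d x y : V}, G.Adj a b → G.Adj b c → G.Adj c d → G.Adj d a →
      a ≠ c → b ≠ d → G.Adj a x → x ≠ b → x ≠ d → G.Adj b y → y = a ∨ y = c := by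
    intro a b c d x y hab hbc hcd hda hac hbd hax hxb hxd hby
    by_contra! hy
    have hxc : x ≠ c := by rintro rfl; exact t hab hbc hax.symm
    have hyd : y ≠ d := by rintro rfl; exact t hab hby hda
    have hxy : x ≠ y := by rintro rfl; exact t hab hby hax.symm
    refine h6 (hasSubgraphCopy_pathGraph_six hax.symm hda.symm hcd.symm hbc.symm hby ?_)
    have := hab.ne
    have := hbc.ne
    have := hcd.ne
    have := hda.ne
    have := hax.ne
    have := hby.ne
    simp only [List.nodup_cons, List.mem_cons, List.not_mem_nil]
    grind
  by_cases hA : ∃ x, G.Adj a x ∧ x ≠ b ∧ x ≠ d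
  · obtain ⟨x, hax, hxb, hxd⟩ := hA
    exact ⟨a, c, key hab hbc hcd hda hac hbd
      (fun v hv => adjacent hab hbc hcd hda hac hbd hax hxb hxd hv)
      (fun v hv => adjacent hda.symm hcd.symm hbc.symm hab.symm hac hbd.symm hax hxd hxb hv)⟩
  by_cases hC : ∃ x, G.Adj c x ∧ x ≠ b ∧ x ≠ d
  · obtain ⟨x, hcx, hxb, hxd⟩ := hC
    exact ⟨a, c, key hab hbc hcd hda hac hbd
      (fun v hv => (adjacent hbc.symm hab.symm hda.symm hcd.symm hac.symm hbd hcx hxb hxd hv).symm)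
      (fun v hv => (adjacent hcd hda hab hbc hac.symm hbd.symm hcx hxd hxb hv).symm)⟩
  push Not at hA hC
  exact ⟨b, d, key hbc hcd hda hab hbd hac.symm
    (fun v hv => or_iff_not_imp_left.2 (hC v hv)) (fun v hv => or_iff_not_imp_left.2 (hA v hv))⟩

/-- Without `C₃`, `C₄`, `C₅` and `P₆`, every edge has an end-vertex with a leaf neighbor. -/
theorem exists_leaf_neighbor {V : Type*} {G : SimpleGraph V}
    (h3 : ¬ HasSubgraphCopy (cycleGraph 3) G) (h5 : ¬ HasSubgraphCopy (cycleGraph 5) G)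
    (h6 : ¬ HasSubgraphCopy (pathGraph 6) G)
    (h4 : ∀ a b c d, G.Adj a b → G.Adj b c → G.Adj c d → G.Adj d a → a ≠ c → b = d)
    {u v : V} (huv : G.Adj u v) :
    (∃ l, G.Adj l u ∧ ∀ w, G.Adj l w → w = u) ∨ (∃ l, G.Adj l v ∧ ∀ w, G.Adj l w → w = v) := by
  have t : ∀ {x y z}, G.Adj x y → G.Adj y z → ¬ G.Adj z x := fun h h' h'' =>
    h3 (hasSubgraphCopy_cycleGraph_three h h' h'')
  by_contra! ⟨hu, hv⟩
  obtain ⟨u₁, huu₁, hu₁⟩ := hv u huv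
  obtain ⟨v₁, hvv₁, hv₁⟩ := hu v huv.symm
  obtain ⟨u₂, huu₂, hu₂⟩ := hu u₁ huu₁.symm
  obtain ⟨v₂, hvv₂, hv₂⟩ := hv v₁ hvv₁.symm
  have n1 : u₁ ≠ v₁ := by rintro rfl; exact t huv hvv₁ huu₁.symm
  have n2 : u₂ ≠ v := by rintro rfl; exact t huv huu₂.symm huu₁.symm
  have n3 : v₂ ≠ u := by rintro rfl; exact t huv hvv₁ hvv₂
  have n4 : u₂ ≠ v₁ := by
    rintro rfl
    exact hu₁ (h4 u v u₂ u₁ huv hvv₁ huu₂.symm huu₁.symm hu₂.symm).symm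
  have n5 : v₂ ≠ u₁ := by
    rintro rfl
    exact hv₂ (h4 u v v₁ v₂ huv hvv₁ hvv₂ huu₁.symm hv₁.symm).symm
  have := huv.ne
  have := huu₁.ne
  have := huu₂.ne
  have := hvv₁.ne
  have := hvv₂.ne
  by_cases n6 : u₂ = v₂
  · subst n6
    refine h5 (hasSubgraphCopy_cycleGraph_five huu₂.symm huu₁.symm huv hvv₁ hvv₂ ?_)
    simp only [List.nodup_cons, List.mem_cons, List.not_mem_nil]
    grind
  · refine h6 (hasSubgraphCopy_pathGraph_six huu₂.symm huu₁.symm huv hvv₁ hvv₂ ?_)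
    simp only [List.nodup_cons, List.mem_cons, List.not_mem_nil]
    grind

/-- If every edge has an end-vertex with a leaf neighbor, replacing the leaves of a dominating set
by their neighbors gives a vertex cover. -/
theorem exists_isVtxCover_of_leaf_neighbor {V : Type*} [Finite V] {G : SimpleGraph V}
    (h : ∀ u v, G.Adj u v →
      (∃ l, G.Adj l u ∧ ∀ w, G.Adj l w → w = u) ∨ (∃ l, G.Adj l v ∧ ∀ w, G.Adj l w → w = v))
    {D : Set V} (hD : IsDomSet G D) : ∃ C, IsVtxCover G C ∧ C.ncard ≤ D.ncard := by
  classical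
  let f : V → V := fun x => if hx : ∃ w, G.Adj x w ∧ ∀ z, G.Adj x z → z = w then hx.choose else x
  have hleaf : ∀ x w, G.Adj x w → (∀ z, G.Adj x z → z = w) → f x = w := by
    intro x w hw hz
    have hx : ∃ w, G.Adj x w ∧ ∀ z, G.Adj x z → z = w := ⟨w, hw, hz⟩
    simp only [f, dif_pos hx]
    exact hz _ hx.choose_spec.1
  have hnon : ∀ x, (¬ ∃ w, G.Adj x w ∧ ∀ z, G.Adj x z → z = w) → f x = x := fun x hx => by
    simp only [f, dif_neg hx]
  have key : ∀ u v, G.Adj u v → (∃ l, G.Adj l u ∧ ∀ w, G.Adj l w → w = u) →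
      u ∈ f '' D ∨ v ∈ f '' D := by
    rintro u v huv ⟨l, hlu, hl⟩
    by_cases hlD : l ∈ D
    · exact Or.inl ⟨l, hlD, hleaf l u hlu hl⟩
    obtain ⟨x, hxD, hx⟩ := hD l hlD
    obtain rfl := hl x hx.symm
    by_cases hu : ∃ w, G.Adj x w ∧ ∀ z, G.Adj x z → z = w
    · obtain ⟨w, hw, hz⟩ := hu
      obtain rfl := hz v huv
      exact Or.inr ⟨x, hxD, hleaf x v hw hz⟩
    · exact Or.inl ⟨x, hxD, hnon x hu⟩
  refine ⟨f '' D, fun u v huv => ?_, Set.ncard_image_le (Set.toFinite D)⟩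
  rcases h u v huv with h | h
  · exact key u v huv h
  · exact (key v u huv.symm h).symm

theorem exists_isVtxCover_ncard_le {V : Type*} [Finite V] {G : SimpleGraph V} (hG : G.Connected)
    (h3 : ¬ HasSubgraphCopy (cycleGraph 3) G) (h5 : ¬ HasSubgraphCopy (cycleGraph 5) G)
    (h6 : ¬ HasSubgraphCopy (pathGraph 6) G) {D : Set V} (hD : IsDomSet G D) :
    ∃ C, IsVtxCover G C ∧ C.ncard ≤ D.ncard := by
  by_cases h4 : ∀ a b c d, G.Adj a b → G.Adj b c → G.Adj c d → G.Adj d a → a ≠ c → b = d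
  · exact exists_isVtxCover_of_leaf_neighbor (fun u v => exists_leaf_neighbor h3 h5 h6 h4) hD
  push Not at h4
  obtain ⟨a, b, c, d, hab, hbc, hcd, hda, hac, hbd⟩ := h4
  rcases le_or_gt D.ncard 1 with h1 | h1
  · refine ⟨D, fun u v huv => ?_, le_rfl⟩
    by_contra! ⟨hu, hv⟩
    obtain ⟨x, hx, hxu⟩ := hD u hu
    obtain ⟨y, hy, hyv⟩ := hD v hv
    obtain rfl := (Set.ncard_le_one (Set.toFinite D)).1 h1 x hx y hy
    exact h3 (hasSubgraphCopy_cycleGraph_three hxu huv hyv.symm)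
  · obtain ⟨x, y, hxy⟩ := exists_isVtxCover_pair hG h3 h6 hab hbc hcd hda hac hbd
    exact ⟨_, hxy, ((Set.ncard_insert_le x {y}).trans (by simp)).trans h1⟩

theorem domNum_eq_covNum {V : Type*} [Finite V] [Nontrivial V] {G : SimpleGraph V}
    (hG : G.Connected) (h3 : ¬ HasSubgraphCopy (cycleGraph 3) G)
    (h5 : ¬ HasSubgraphCopy (cycleGraph 5) G) (h6 : ¬ HasSubgraphCopy (pathGraph 6) G) :
    domNum G = covNum G := by
  have hdne : {n | ∃ D : Set V, IsDomSet G D ∧ D.ncard = n}.Nonempty :=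
    ⟨_, Set.univ, fun _ hv => (hv trivial).elim, rfl⟩
  have hcne : {n | ∃ C : Set V, IsVtxCover G C ∧ C.ncard = n}.Nonempty :=
    ⟨_, Set.univ, fun _ _ _ => Or.inl trivial, rfl⟩
  apply le_antisymm
  · obtain ⟨C, hC, hcard⟩ := Nat.sInf_mem hcne
    refine Nat.sInf_le ⟨C, fun v hv => ?_, hcard⟩
    obtain ⟨u, hu⟩ := hG.preconnected.exists_adj_of_nontrivial v
    exact ⟨u, (hC hu).resolve_left hv, hu.symm⟩
  · obtain ⟨D, hD, hcard⟩ := Nat.sInf_mem hdne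
    obtain ⟨C, hC, hle⟩ := exists_isVtxCover_ncard_le hG h3 h5 h6 hD
    have hcov : covNum G ≤ C.ncard := Nat.sInf_le ⟨C, hC, rfl⟩
    exact hcov.trans (hle.trans hcard.le)

/-- A non-trivial connected graph `G` is γβ-perfect if and only if `G` is not isomorphic
to `C₅` and `G` contains neither `C₃` nor `P₆` as a subgraph. -/
theorem gammaBetaPerfect_iff_forbidden {V : Type*} [Fintype V] (G : SimpleGraph V)
    (hconn : G.Connected) (hnontrivial : 2 ≤ Fintype.card V) :
    GammaBetaPerfect G ↔
      ¬ Nonempty (G ≃g cycleGraph 5) ∧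
        ¬ HasSubgraphCopy (cycleGraph 3) G ∧ ¬ HasSubgraphCopy (pathGraph 6) G := by
  constructor
  · intro hG
    refine ⟨?_, ?_, ?_⟩
    · rintro ⟨e⟩
      exact not_gammaBetaPerfect_of_copy (F := cycleGraph 5) cycleGraph_connected (by simp)
        {0, 2} (by decide) (by decide) ⟨e.symm.toHom, e.symm.injective⟩ hG
    · intro h
      exact not_gammaBetaPerfect_of_copy (F := cycleGraph 3) cycleGraph_connected (by simp)
        {0} (by decide) (by decide) h hG
    · intro h
      exact not_gammaBetaPerfect_of_copy (F := pathGraph 6) (pathGraph_connected 5) (by simp)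
        {1, 4} (by simp only [pathGraph_adj]; decide) (by simp only [pathGraph_adj]; decide) h hG
  · rintro ⟨hiso, h3, h6⟩
    refine ⟨hconn, hnontrivial, fun S hS hcard => ?_⟩
    have : Nontrivial S := Set.nontrivial_coe_sort.2 (Set.one_lt_ncard_iff_nontrivial.1 hcard)
    exact domNum_eq_covNum hS (fun h => h3 h.of_induce)
      (fun h => hiso (nonempty_iso_cycleGraph_five hconn h3 h6 h.of_induce))
      (fun h => h6 h.of_induce)
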